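/- Let δ ∈ {0, 1} and let A be an integer with A ≥ max(δ, 1); set N = A + 1 − δ. Define P := ∏_{1 ≤ i < j ≤ N} (1 − q^{i+j+2δ−2})² / [ ∏_{1 ≤ i < j ≤ N} (1 − q^{i+j+2δ−1}) · ∏_{1 ≤ i < j ≤ N, i+j+2δ−3 ≠ 0} (1 − q^{i+j+2δ−3}) ]. Then, exactly in ℚ(q): if A + δ is even, P = ∏_{e odd, 2δ+1 ≤ e ≤ 2A−1} (1 − q^{e}) / ∏_{e even, max(2δ, 2) ≤ e ≤ 2A, e ≠ A+δ} (1 − q^{e}); and if A + δ is odd, P = (1 − q^{A+δ}) · ∏_{e odd, 2δ+1 ≤ e ≤ 2A−1} (1 − q^{e}) / ∏_{e even, max(2δ, 2) ≤ e ≤ 2A} (1 − q^{e}). (P is the regularized μ-function factor coming from the type-D roots whose coordinate sum is nonzero, evaluated at the point with consecutive coordinates (q^{δ}, q^{δ+1}, …, q^{A}).) -/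

import Mathlib

/-!
STATEMENT 11. Evaluation of the regularized μ-factor coming from the type-D roots with
nonzero coordinate sum at the point with consecutive coordinates `(q^δ, q^{δ+1}, …, q^A)`,
where `δ ∈ {0,1}`, `A ≥ max(δ,1)` and `N = A + 1 - δ`.
-/

noncomputable section

/-- The field `ℚ(q)`. -/
abbrev RF11 : Type := RatFunc ℚ

/-- The indeterminate `q`. -/
def qR : RF11 := RatFunc.X

/-- The pairs `1 ≤ i < j ≤ N`. -/
def pairsUpTo (N : ℕ) : Finset (ℕ × ℕ) :=
  (Finset.Icc 1 N ×ˢ Finset.Icc 1 N).filter fun p => p.1 < p.2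

/-- `P = ∏_{1≤i<j≤N}(1-q^{i+j+2δ-2})² /
      [∏_{1≤i<j≤N}(1-q^{i+j+2δ-1}) · ∏_{1≤i<j≤N, i+j+2δ-3≠0}(1-q^{i+j+2δ-3})]`
with `N = A + 1 - δ`. -/
def P4dExpr (δ A : ℕ) : RF11 :=
  (∏ p ∈ pairsUpTo (A + 1 - δ), (1 - qR ^ (p.1 + p.2 + 2 * δ - 2)) ^ 2) /
    ((∏ p ∈ pairsUpTo (A + 1 - δ), (1 - qR ^ (p.1 + p.2 + 2 * δ - 1))) *
      ∏ p ∈ (pairsUpTo (A + 1 - δ)).filter (fun p => p.1 + p.2 + 2 * δ - 3 ≠ 0),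
        (1 - qR ^ (p.1 + p.2 + 2 * δ - 3)))

/-- The product `∏_{e odd, 2δ+1 ≤ e ≤ 2A-1}(1-q^e)`. -/
def oddProd (δ A : ℕ) : RF11 :=
  ∏ e ∈ (Finset.Icc (2 * δ + 1) (2 * A - 1)).filter (fun e => e % 2 = 1), (1 - qR ^ e)

/-- The factor `1 - q^e`, with the vanishing factor at `e = 0` replaced by `1`. -/
def regFactor (e : ℕ) : RF11 := if e = 0 then 1 else 1 - qR ^ e

theorem regFactor_zero : regFactor 0 = 1 := if_pos rfl

theorem regFactor_of_ne_zero {e : ℕ} (he : e ≠ 0) : regFactor e = 1 - qR ^ e := if_neg he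

theorem regFactor_ne_zero (e : ℕ) : regFactor e ≠ 0 := by
  unfold regFactor
  split_ifs with he
  · exact one_ne_zero
  · intro h
    have hX : (Polynomial.X ^ e : Polynomial ℚ) = 1 := by
      apply RatFunc.algebraMap_injective ℚ
      rw [map_pow, RatFunc.algebraMap_X, map_one]
      exact (sub_eq_zero.mp h).symm
    have hdeg := congrArg Polynomial.natDegree hX
    rw [Polynomial.natDegree_X_pow, Polynomial.natDegree_one] at hdeg
    exact he hdeg

theorem prod_range_sq_div_telescope {K : Type*} [Field K] {g : ℕ → K} (hg : ∀ e, g e ≠ 0)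
    (m n : ℕ) :
    ∏ i ∈ Finset.range n, g (m + i + 1) ^ 2 / (g (m + i + 2) * g (m + i)) =
      g (m + 1) * g (m + n) / (g m * g (m + n + 1)) := by
  induction n with
  | zero =>
    rw [Finset.prod_range_zero, add_zero, mul_comm, div_self (mul_ne_zero (hg _) (hg _))]
  | succ n ih =>
    rw [Finset.prod_range_succ, ih, ← add_assoc]
    have h₀ := hg m
    have h₁ := hg (m + n)
    have h₂ := hg (m + n + 1)
    have h₃ := hg (m + n + 2)
    rw [show m + n + 1 + 1 = m + n + 2 from rfl]
    field_simp

theorem prod_pairsUpTo_succ {M : Type*} [CommMonoid M] (F : ℕ × ℕ → M) (N : ℕ) :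
    ∏ p ∈ pairsUpTo (N + 1), F p =
      (∏ p ∈ pairsUpTo N, F p) * ∏ i ∈ Finset.range N, F (i + 1, N + 1) := by
  have hinj : Set.InjOn (fun i : ℕ => (i + 1, N + 1)) (Finset.range N : Set ℕ) := by
    intro a _ b _ h
    simpa using h
  rw [← Finset.prod_image (f := F) hinj, ← Finset.prod_union]
  · congr 1
    ext ⟨a, b⟩
    simp only [pairsUpTo, Finset.mem_filter, Finset.mem_product, Finset.mem_Icc,
      Finset.mem_union, Finset.mem_image, Finset.mem_range, Prod.mk.injEq]
    constructor
    · intro h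
      by_cases hb : b = N + 1
      · exact Or.inr ⟨a - 1, by omega, by omega, hb.symm⟩
      · left; omega
    · rintro (h | ⟨i, hi, rfl, rfl⟩) <;> omega
  · rw [Finset.disjoint_left]
    rintro ⟨a, b⟩ h h'
    simp only [pairsUpTo, Finset.mem_filter, Finset.mem_product, Finset.mem_Icc,
      Finset.mem_image, Finset.mem_range, Prod.mk.injEq] at h h'
    obtain ⟨i, hi, h₁, h₂⟩ := h'
    omega

theorem P4dExpr_eq_prod_regFactor (δ A : ℕ) :
    P4dExpr δ A =
      ∏ p ∈ pairsUpTo (A + 1 - δ), regFactor (p.1 + p.2 + 2 * δ - 2) ^ 2 /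
        (regFactor (p.1 + p.2 + 2 * δ - 1) * regFactor (p.1 + p.2 + 2 * δ - 3)) := by
  have hpos : ∀ p ∈ pairsUpTo (A + 1 - δ), 1 ≤ p.1 ∧ p.1 < p.2 := by
    intro p hp
    simp only [pairsUpTo, Finset.mem_filter, Finset.mem_product, Finset.mem_Icc] at hp
    omega
  rw [Finset.prod_div_distrib, Finset.prod_mul_distrib, P4dExpr, Finset.prod_filter]
  congr 1
  · refine Finset.prod_congr rfl fun p hp => ?_
    rw [regFactor_of_ne_zero (by have := hpos p hp; omega)]
  · congr 1
    · refine Finset.prod_congr rfl fun p hp => ?_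
      rw [regFactor_of_ne_zero (by have := hpos p hp; omega)]
    · refine Finset.prod_congr rfl fun p _ => ?_
      rw [regFactor, ite_not]

theorem P4dExpr_self (δ : ℕ) : P4dExpr δ δ = 1 := by
  have h : pairsUpTo (δ + 1 - δ) = ∅ := by
    rw [Nat.add_sub_cancel_left]
    rfl
  rw [P4dExpr_eq_prod_regFactor, h, Finset.prod_empty]

theorem P4dExpr_succ {δ A : ℕ} (h : δ ≤ A) :
    P4dExpr δ (A + 1) =
      P4dExpr δ A * (regFactor (A + δ + 1) * regFactor (2 * A + 1) /
        (regFactor (A + δ) * regFactor (2 * A + 2))) := by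
  rw [P4dExpr_eq_prod_regFactor, P4dExpr_eq_prod_regFactor,
    show A + 1 + 1 - δ = (A + 1 - δ) + 1 by omega, prod_pairsUpTo_succ]
  congr 1
  have ht := prod_range_sq_div_telescope regFactor_ne_zero (A + δ) (A + 1 - δ)
  rw [show A + δ + (A + 1 - δ) = 2 * A + 1 by omega] at ht
  rw [← ht]
  refine Finset.prod_congr rfl fun i _ => ?_
  dsimp only
  congr 3 <;> first | rfl | omega

/-- The product `∏_{e even, max(2δ,2) ≤ e ≤ 2A}(1-q^e)`. -/
def evenProd (δ A : ℕ) : RF11 :=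
  ∏ e ∈ (Finset.Icc (max (2 * δ) 2) (2 * A)).filter (fun e => e % 2 = 0), (1 - qR ^ e)

theorem oddProd_succ {δ A : ℕ} (h : δ ≤ A) :
    oddProd δ (A + 1) = oddProd δ A * regFactor (2 * A + 1) := by
  have hs : (Finset.Icc (2 * δ + 1) (2 * (A + 1) - 1)).filter (fun e => e % 2 = 1) =
      insert (2 * A + 1)
        ((Finset.Icc (2 * δ + 1) (2 * A - 1)).filter (fun e => e % 2 = 1)) := by
    ext e
    simp only [Finset.mem_filter, Finset.mem_Icc, Finset.mem_insert]
    omega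
  rw [oddProd, hs, Finset.prod_insert, ← oddProd, regFactor_of_ne_zero (by omega), mul_comm]
  simp only [Finset.mem_filter, Finset.mem_Icc]
  omega

theorem evenProd_succ {δ A : ℕ} (h : δ ≤ A) :
    evenProd δ (A + 1) = evenProd δ A * regFactor (2 * A + 2) := by
  have hs : (Finset.Icc (max (2 * δ) 2) (2 * (A + 1))).filter (fun e => e % 2 = 0) =
      insert (2 * A + 2)
        ((Finset.Icc (max (2 * δ) 2) (2 * A)).filter (fun e => e % 2 = 0)) := by
    ext e
    simp only [Finset.mem_filter, Finset.mem_Icc, Finset.mem_insert]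
    omega
  rw [evenProd, hs, Finset.prod_insert, ← evenProd, regFactor_of_ne_zero (by omega), mul_comm]
  simp only [Finset.mem_filter, Finset.mem_Icc]
  omega

theorem oddProd_self (δ : ℕ) : oddProd δ δ = 1 := by
  rw [oddProd, Finset.Icc_eq_empty (by omega), Finset.filter_empty, Finset.prod_empty]

theorem evenProd_self (δ : ℕ) : evenProd δ δ = regFactor (2 * δ) := by
  rcases Nat.eq_zero_or_pos δ with rfl | hδ
  · exact regFactor_zero.symm
  · rw [evenProd, max_eq_left (by omega), Finset.Icc_self, Finset.filter_singleton,
      if_pos (by omega), Finset.prod_singleton, regFactor_of_ne_zero (by omega)]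

theorem evenProd_ne_zero (δ A : ℕ) : evenProd δ A ≠ 0 := by
  refine Finset.prod_ne_zero_iff.mpr fun e he => ?_
  simp only [Finset.mem_filter, Finset.mem_Icc] at he
  rw [← regFactor_of_ne_zero (by omega)]
  exact regFactor_ne_zero e

theorem P4dExpr_eq {δ A : ℕ} (h : δ ≤ A) :
    P4dExpr δ A = regFactor (A + δ) * oddProd δ A / evenProd δ A := by
  induction A, h using Nat.le_induction with
  | base =>
    rw [P4dExpr_self, oddProd_self, evenProd_self, mul_one, ← two_mul,
      div_self (regFactor_ne_zero _)]
  | succ A h ih =>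
    rw [P4dExpr_succ h, ih, oddProd_succ h, evenProd_succ h, add_right_comm A 1 δ]
    have h₁ := regFactor_ne_zero (A + δ)
    have h₂ := regFactor_ne_zero (2 * A + 2)
    have h₃ := evenProd_ne_zero δ A
    field_simp

theorem statement11 (δ A : ℕ) (hδ : δ = 0 ∨ δ = 1) (hA : max δ 1 ≤ A) :
    ((A + δ) % 2 = 0 →
        P4dExpr δ A =
          oddProd δ A /
            ∏ e ∈ (Finset.Icc (max (2 * δ) 2) (2 * A)).filter
                (fun e => e % 2 = 0 ∧ e ≠ A + δ), (1 - qR ^ e)) ∧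
      ((A + δ) % 2 = 1 →
        P4dExpr δ A =
          (1 - qR ^ (A + δ)) * oddProd δ A /
            ∏ e ∈ (Finset.Icc (max (2 * δ) 2) (2 * A)).filter (fun e => e % 2 = 0),
              (1 - qR ^ e)) := by
  have hle : δ ≤ A := (le_max_left _ _).trans hA
  have hpos : 1 ≤ A := (le_max_right _ _).trans hA
  rw [P4dExpr_eq hle]
  refine ⟨fun hpar => ?_, fun _ => ?_⟩
  · have hmem : A + δ ∈
        (Finset.Icc (max (2 * δ) 2) (2 * A)).filter (fun e => e % 2 = 0) := by
      simp only [Finset.mem_filter, Finset.mem_Icc]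
      omega
    have herase : (Finset.Icc (max (2 * δ) 2) (2 * A)).filter
        (fun e => e % 2 = 0 ∧ e ≠ A + δ) =
        ((Finset.Icc (max (2 * δ) 2) (2 * A)).filter (fun e => e % 2 = 0)).erase (A + δ) := by
      ext e
      simp only [Finset.mem_filter, Finset.mem_erase]
      tauto
    rw [herase, evenProd, ← Finset.mul_prod_erase _ _ hmem,
      ← regFactor_of_ne_zero (show A + δ ≠ 0 by omega),
      mul_div_mul_left _ _ (regFactor_ne_zero _)]
  · rw [regFactor_of_ne_zero (show A + δ ≠ 0 by omega), evenProd]
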